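/- Let ψ : ℝ_{>0} → ℝ_{≥0} be a non-increasing function such that ∑_{q=1}^{∞} ψ(q) diverges. For x ∈ ℝ and T > 0, let N_{ψ,x}(T) be the number of rational numbers p/q (written in lowest terms with q ≥ 1) such that |x − p/q| < ψ(q)/q and 1 ≤ q < T. Then for Lebesgue-almost every x ∈ ℝ: lim_{T→∞} N_{ψ,x}(T) / ( 2·ζ(2)^{−1}·∑_{q=1}^{⌊T⌋} ψ(q) ) = 1. -/

import Mathlib

open MeasureTheory Filter

section

open scoped ENNReal

theorem tsum_setLIntegral_sub_int (F : ℝ → ℝ≥0∞) (t : ℝ) :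
    ∑' n : ℤ, ∫⁻ x in Set.Ioc t (t + 1), F (x - n) = ∫⁻ x, F x := by
  have h1 : ∀ n : ℤ, ∫⁻ x in Set.Ioc t (t + 1), F (x - n) =
      ∫⁻ x in Set.Ioc (t + (-n : ℤ)) (t + (-n : ℤ) + 1), F x := by
    intro n
    have := (measurePreserving_sub_right volume (n : ℝ)).setLIntegral_comp_emb
      (measurableEmbedding_subRight (n : ℝ)) F (Set.Ioc t (t + 1))
    rw [this]
    congr 2
    simp only [Set.image_sub_const_Ioc]
    push_cast
    congr 1; ring
  simp_rw [h1]
  rw [tsum_congr fun n : ℤ => by rw [← Equiv.neg_apply], (Equiv.neg ℤ).tsum_eq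
      (fun n : ℤ => ∫⁻ x in Set.Ioc (t + (n : ℝ)) (t + (n : ℝ) + 1), F x),
    ← lintegral_iUnion (fun _ => measurableSet_Ioc), iUnion_Ioc_add_intCast, setLIntegral_univ]
  exact Set.pairwise_disjoint_Ioc_add_intCast t

theorem tsum_setLIntegral_sub_int_div (F : ℝ → ℝ≥0∞) (t : ℝ) (d : ℕ) (hd : 0 < d) :
    ∑' n : ℤ, ∫⁻ x in Set.Ioc t (t + 1), F (x - n / d) = d * ∫⁻ x, F x := by
  have : NeZero d := ⟨hd.ne'⟩
  have hd' : (d : ℝ) ≠ 0 := by positivity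
  rw [← (Int.divModEquiv d).symm.tsum_eq, ENNReal.tsum_prod', ENNReal.tsum_comm, tsum_fintype]
  have : ∀ j : Fin d, ∑' n : ℤ, ∫⁻ x in Set.Ioc t (t + 1),
      F (x - ((Int.divModEquiv d).symm (n, j) : ℤ) / d) = ∫⁻ x, F x := by
    intro j
    rw [← lintegral_sub_right_eq_self F ((j : ℝ) / d),
      ← tsum_setLIntegral_sub_int (fun x => F (x - (j : ℝ) / d)) t]
    refine tsum_congr fun n => lintegral_congr fun x => ?_
    congr 1
    simp only [Int.divModEquiv_symm_apply]
    push_cast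
    field_simp
    ring
  simp_rw [this]
  simp

/-- The length of the overlap of two centred intervals of radii `α`, `β` after translation. -/
theorem lintegral_volume_ball_inter (α β : ℝ) :
    ∫⁻ t : ℝ, volume (Metric.ball (0 : ℝ) α ∩ Metric.ball t β) =
      ENNReal.ofReal (2 * α) * ENNReal.ofReal (2 * β) := by
  have h : ∀ t : ℝ, volume (Metric.ball (0 : ℝ) α ∩ Metric.ball t β) =
      ∫⁻ y in Metric.ball (0 : ℝ) α, (Metric.ball t β).indicator 1 y := by
    intro t
    rw [lintegral_indicator_one measurableSet_ball, Measure.restrict_apply measurableSet_ball,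
      Set.inter_comm]
  simp_rw [h]
  rw [lintegral_lintegral_swap]
  · have : ∀ y : ℝ, ∫⁻ t : ℝ, (Metric.ball t β).indicator (1 : ℝ → ℝ≥0∞) y =
        ENNReal.ofReal (2 * β) := by
      intro y
      rw [← Real.volume_ball y β, ← lintegral_indicator_one measurableSet_ball]
      refine lintegral_congr fun t => ?_
      simp only [Set.indicator, Metric.mem_ball, dist_comm, Pi.one_apply]
    simp_rw [this]
    rw [setLIntegral_const, Real.volume_ball, mul_comm]
  · apply Measurable.aemeasurable
    have : MeasurableSet {z : ℝ × ℝ | dist z.2 z.1 < β} :=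
      measurableSet_lt (by fun_prop) (by fun_prop)
    exact (measurable_one.indicator this : Measurable
      ({z : ℝ × ℝ | dist z.2 z.1 < β}.indicator (1 : ℝ × ℝ → ℝ≥0∞)))

theorem volume_ball_inter_le {α β s t : ℝ} (hs : |s| ≤ |t|) :
    volume (Metric.ball (0 : ℝ) α ∩ Metric.ball t β) ≤
      volume (Metric.ball (0 : ℝ) α ∩ Metric.ball s β) := by
  simp only [Real.ball_eq_Ioo, Set.Ioo_inter_Ioo, Real.volume_Ioo]
  apply ENNReal.ofReal_le_ofReal
  rcases abs_cases s with h | h <;> rcases abs_cases t with h' | h' <;>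
  simp only [min_def, max_def] <;> split_ifs <;> linarith

theorem tsum_volume_ball_inter_le (α β τ : ℝ) (hτ : 0 < τ) :
    ∑' k : {k : ℤ // k ≠ 0}, ENNReal.ofReal τ *
        volume (Metric.ball (0 : ℝ) α ∩ Metric.ball ((k : ℤ) * τ) β) ≤
      ENNReal.ofReal (2 * α) * ENNReal.ofReal (2 * β) := by
  rw [← lintegral_volume_ball_inter]
  set H : ℝ → ℝ≥0∞ := fun t => volume (Metric.ball (0 : ℝ) α ∩ Metric.ball t β)
  have hpart : ∑' n : ℤ, ∫⁻ t in Set.Ioc (n * τ) ((n + 1) * τ), H t = ∫⁻ t, H t := by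
    have := iUnion_Ioc_zsmul hτ
    have h2 := Set.pairwise_disjoint_Ioc_zsmul τ
    simp only [zsmul_eq_mul, Int.cast_add, Int.cast_one] at this h2
    rw [← lintegral_iUnion (fun _ => measurableSet_Ioc) h2, this, setLIntegral_univ]
  let e : {k : ℤ // k ≠ 0} → ℤ := fun k => if 0 < (k : ℤ) then k - 1 else k
  have he : Function.Injective e := by
    rintro ⟨a, ha⟩ ⟨b, hb⟩ h
    simp only [e] at h
    rw [Subtype.mk.injEq]
    split_ifs at h <;> omega
  have hk : ∀ k : {k : ℤ // k ≠ 0}, ENNReal.ofReal τ * H ((k : ℤ) * τ) ≤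
      ∫⁻ t in Set.Ioc (e k * τ) ((e k + 1) * τ), H t := by
    rintro ⟨k, hk⟩
    have hvol : volume (Set.Ioc (e ⟨k, hk⟩ * τ) ((e ⟨k, hk⟩ + 1) * τ)) = ENNReal.ofReal τ := by
      rw [Real.volume_Ioc]; congr 1; ring
    rw [← hvol, mul_comm, ← setLIntegral_const]
    refine setLIntegral_mono' measurableSet_Ioc fun t ht => volume_ball_inter_le ?_
    simp only [e] at ht
    rcases lt_or_gt_of_ne hk with h | h
    · rw [if_neg (by omega)] at ht
      have hk1 : (k : ℝ) + 1 ≤ 0 := by exact_mod_cast (by omega : k + 1 ≤ 0)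
      have : t ≤ 0 := ht.2.trans (mul_nonpos_of_nonpos_of_nonneg hk1 hτ.le)
      rw [abs_of_nonpos this, abs_of_nonpos (ht.1.le.trans this)]
      linarith [ht.1]
    · rw [if_pos h] at ht
      have hk1 : (0 : ℝ) ≤ (k : ℝ) - 1 := by exact_mod_cast (by omega : 0 ≤ k - 1)
      push_cast at ht
      have h2 : 0 ≤ t := (mul_nonneg hk1 hτ.le).trans ht.1.le
      rw [abs_of_nonneg h2, abs_of_nonneg (by nlinarith)]
      linarith [ht.2]
  calc _ ≤ ∑' k : {k : ℤ // k ≠ 0}, ∫⁻ t in Set.Ioc (e k * τ) ((e k + 1) * τ), H t :=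
        ENNReal.tsum_le_tsum hk
    _ ≤ ∑' n : ℤ, ∫⁻ t in Set.Ioc (n * τ) ((n + 1) * τ), H t :=
        ENNReal.tsum_comp_le_tsum_of_injective he
          (fun n : ℤ => ∫⁻ t in Set.Ioc (n * τ) ((n + 1) * τ), H t)
    _ = _ := hpart

theorem tsum_restrict_volume_ball (t δ : ℝ) (q : ℕ) (hq : 0 < q) :
    ∑' p : ℤ, volume.restrict (Set.Ioc t (t + 1)) (Metric.ball ((p : ℝ) / q) (δ / q)) =
      ENNReal.ofReal (2 * δ) := by
  have h := tsum_setLIntegral_sub_int_div ((Metric.ball (0 : ℝ) (δ / q)).indicator 1) t q hq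
  rw [lintegral_indicator_one measurableSet_ball, Real.volume_ball] at h
  have hq' : (0 : ℝ) < q := by positivity
  rw [← ENNReal.ofReal_natCast, ← ENNReal.ofReal_mul hq'.le] at h
  convert h using 2
  · ext p
    rw [← lintegral_indicator_one measurableSet_ball]
    refine lintegral_congr fun x => ?_
    simp [Set.indicator, Real.dist_eq]
  · field_simp

/-- Pairs of non-proportional fractions are at most as correlated as independent events. -/
theorem tsum_restrict_volume_ball_inter_le (t δ ε : ℝ) (q r : ℕ) (hq : 0 < q) (hr : 0 < r) :
    ∑' w : ℤ × ℤ, (if w.1 * r ≠ w.2 * q then volume.restrict (Set.Ioc t (t + 1))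
        (Metric.ball ((w.1 : ℝ) / q) (δ / q) ∩ Metric.ball ((w.2 : ℝ) / r) (ε / r)) else 0) ≤
      ENNReal.ofReal (2 * δ) * ENNReal.ofReal (2 * ε) := by
  obtain ⟨d, q', r', hd, hcop, hqd, hrd⟩ : ∃ d q' r' : ℕ, 0 < d ∧ q'.Coprime r' ∧
      q = q' * d ∧ r = r' * d := by
    obtain ⟨g, hg⟩ := Nat.exists_coprime q r
    exact ⟨q.gcd r, g, hg.choose, Nat.gcd_pos_of_pos_left _ hq, hg.choose_spec.1,
      hg.choose_spec.2.1, hg.choose_spec.2.2⟩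
  obtain ⟨u, v, huv⟩ := (Nat.isCoprime_iff_coprime.2 hcop)
  have hq0 : (0 : ℝ) < q := by positivity
  have hr0 : (0 : ℝ) < r := by positivity
  have hd0 : (0 : ℝ) < d := by positivity
  have hqR : (q : ℝ) = q' * d := by exact_mod_cast hqd
  have hrR : (r : ℝ) = r' * d := by exact_mod_cast hrd
  have hq'0 : (0 : ℝ) < q' := pos_of_mul_pos_left (hqR ▸ hq0) hd0.le
  have hr'0 : (0 : ℝ) < r' := pos_of_mul_pos_left (hrR ▸ hr0) hd0.le
  have huvR : (u : ℝ) * q' + v * r' = 1 := by exact_mod_cast huv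
  let e : ℤ × ℤ ≃ ℤ × ℤ :=
    { toFun := fun z => (z.1 * v + z.2 * q', -z.1 * u + z.2 * r')
      invFun := fun w => (w.1 * r' - w.2 * q', w.1 * u + w.2 * v)
      left_inv := by
        rintro ⟨k, n⟩
        ext
        · simp only; linear_combination k * huv
        · simp only; linear_combination n * huv
      right_inv := by
        rintro ⟨p, s⟩
        ext
        · simp only; linear_combination p * huv
        · simp only; linear_combination s * huv }
  set τ : ℝ := d / (q * r) with hτ
  have hτ0 : 0 < τ := by positivity
  have hterm : ∀ k n : ℤ, (if (e (k, n)).1 * r ≠ (e (k, n)).2 * q then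
        volume.restrict (Set.Ioc t (t + 1)) (Metric.ball (((e (k, n)).1 : ℝ) / q) (δ / q) ∩
          Metric.ball (((e (k, n)).2 : ℝ) / r) (ε / r)) else 0) =
      if k ≠ 0 then ∫⁻ x in Set.Ioc t (t + 1),
        (Metric.ball (k * v / q : ℝ) (δ / q) ∩ Metric.ball (-k * u / r : ℝ) (ε / r)).indicator
          1 (x - n / d) else 0 := by
    intro k n
    have hc : (e (k, n)).1 * r ≠ (e (k, n)).2 * q ↔ k ≠ 0 := by
      have : (e (k, n)).1 * r - (e (k, n)).2 * q = k * d := by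
        simp only [e, Equiv.coe_fn_mk, hqd, hrd]
        push_cast
        linear_combination k * d * huv
      rw [ne_eq, ← sub_eq_zero, this, mul_eq_zero]
      simp [hd.ne']
    simp only [hc]
    split_ifs
    · rw [← lintegral_indicator_one (measurableSet_ball.inter measurableSet_ball)]
      refine lintegral_congr fun x => ?_
      have e1 : x - ((e (k, n)).1 : ℝ) / q = x - n / d - k * v / q := by
        simp only [e, Equiv.coe_fn_mk, hqR]
        push_cast
        field_simp
        ring
      have e2 : x - ((e (k, n)).2 : ℝ) / r = x - n / d - (-k * u / r) := by
        simp only [e, Equiv.coe_fn_mk, hrR]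
        push_cast
        field_simp
        ring
      simp only [Set.indicator, Set.mem_inter_iff, Metric.mem_ball, Real.dist_eq, e1, e2,
        Pi.one_apply]
    · rfl
  have hk : ∀ k : ℤ, volume (Metric.ball (k * v / q : ℝ) (δ / q) ∩
      Metric.ball (-k * u / r : ℝ) (ε / r)) ≤
      volume (Metric.ball (0 : ℝ) (δ / q) ∩ Metric.ball (k * τ) (ε / r)) := by
    intro k
    have : (Metric.ball (k * v / q : ℝ) (δ / q) ∩ Metric.ball (-k * u / r : ℝ) (ε / r)) =
        (fun x => x - (k * v / q : ℝ)) ⁻¹' (Metric.ball (0 : ℝ) (δ / q) ∩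
          Metric.ball (-k * τ) (ε / r)) := by
      ext x
      have e2 : x - k * v / q - -k * τ = x - (-k * u / r) := by
        rw [hτ, hqR, hrR]
        field_simp
        linear_combination (-k : ℝ) * huvR
      simp only [Set.mem_inter_iff, Metric.mem_ball, Real.dist_eq, Set.mem_preimage, e2, sub_zero]
    rw [this, (measurePreserving_sub_right volume (k * v / q : ℝ)).measure_preimage
      (measurableSet_ball.inter measurableSet_ball).nullMeasurableSet]
    exact volume_ball_inter_le (by simp)
  rw [← e.tsum_eq, ENNReal.tsum_prod']
  simp_rw [hterm]
  have hsum : ∀ k : ℤ, (∑' n : ℤ, if k ≠ 0 then ∫⁻ x in Set.Ioc t (t + 1),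
        (Metric.ball (k * v / q : ℝ) (δ / q) ∩ Metric.ball (-k * u / r : ℝ) (ε / r)).indicator
          (1 : ℝ → ℝ≥0∞) (x - n / d) else 0) ≤
      {k : ℤ | k ≠ 0}.indicator (fun k : ℤ => ENNReal.ofReal (q * r) * (ENNReal.ofReal τ *
        volume (Metric.ball (0 : ℝ) (δ / q) ∩ Metric.ball (k * τ) (ε / r)))) k := by
    intro k
    by_cases h : k ≠ 0
    · simp only [h, ne_eq, not_false_eq_true, if_true, Set.indicator, Set.mem_ofPred_eq]
      have := tsum_setLIntegral_sub_int_div ((Metric.ball (k * v / q : ℝ) (δ / q) ∩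
        Metric.ball (-k * u / r : ℝ) (ε / r)).indicator (1 : ℝ → ℝ≥0∞)) t d hd
      simp only [Set.indicator] at this
      rw [this]
      have h3 := lintegral_indicator_one (μ := volume) ((measurableSet_ball (x :=
        (k * v / q : ℝ)) (ε := δ / q)).inter (measurableSet_ball (x := (-k * u / r : ℝ))
          (ε := ε / r)))
      simp only [Set.indicator] at h3
      rw [h3, ← mul_assoc, ← ENNReal.ofReal_mul (by positivity), ← ENNReal.ofReal_natCast]
      have : (q * r : ℝ) * τ = d := by rw [hτ]; field_simp
      rw [this]
      exact mul_le_mul_right (hk k) _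
    · simp [h]
  refine (ENNReal.tsum_le_tsum hsum).trans ?_
  rw [← tsum_subtype]
  rw [ENNReal.tsum_mul_left]
  refine (mul_le_mul_right (tsum_volume_ball_inter_le _ _ _ hτ0) _).trans (le_of_eq ?_)
  by_cases hδ : δ ≤ 0
  · rw [ENNReal.ofReal_of_nonpos (p := 2 * δ) (by linarith),
      ENNReal.ofReal_of_nonpos (p := 2 * (δ / q)) (by
        have := div_nonpos_of_nonpos_of_nonneg hδ hq0.le
        linarith)]
    simp
  · push Not at hδ
    rw [← ENNReal.ofReal_mul (by positivity), ← ENNReal.ofReal_mul (by positivity),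
      ← ENNReal.ofReal_mul (by positivity)]
    congr 1
    field_simp

theorem integral_abs_sub_le_of_sq {Ω : Type*} [MeasurableSpace Ω] {μ : Measure Ω}
    [IsProbabilityMeasure μ] {f g : Ω → ℝ} (hf : Integrable f μ) (hg : Integrable g μ)
    (hg2 : Integrable (fun x => g x ^ 2) μ) (hgf : ∀ x, g x ≤ f x) {a η κ T : ℝ} (ha : 0 ≤ a)
    (hT : 0 < T) (hfa : ∫ x, f x ∂μ = a) (hga : a - η ≤ ∫ x, g x ∂μ)
    (hg2a : ∫ x, g x ^ 2 ∂μ ≤ a ^ 2 + κ) :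
    ∫ x, |f x - a| ∂μ ≤ T + (2 * a * η + κ) / T := by
  have hpt : ∀ x, |f x - a| ≤ (f x - a) + (T + (a ^ 2 - 2 * a * g x + g x ^ 2) / T) := by
    intro x
    have h1 : 2 * (a - g x) ≤ T + (a ^ 2 - 2 * a * g x + g x ^ 2) / T := by
      rw [← sub_nonneg]
      have : T + (a ^ 2 - 2 * a * g x + g x ^ 2) / T - 2 * (a - g x) =
          (T - (a - g x)) ^ 2 / T := by field_simp; ring
      rw [this]; positivity
    have h2 : 0 ≤ T + (a ^ 2 - 2 * a * g x + g x ^ 2) / T := by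
      have : a ^ 2 - 2 * a * g x + g x ^ 2 = (a - g x) ^ 2 := by ring
      rw [this]; positivity
    rcases abs_cases (f x - a) with h | h <;> linarith [hgf x]
  have hi1 : Integrable (fun x => f x - a) μ := hf.sub (integrable_const a)
  have hi2 : Integrable (fun x => a ^ 2 - 2 * a * g x + g x ^ 2) μ :=
    ((integrable_const _).sub (hg.const_mul _)).add hg2
  have hi4 : Integrable (fun x => a ^ 2 - 2 * a * g x) μ :=
    (integrable_const _).sub (hg.const_mul _)
  have hi3 : Integrable (fun x => T + (a ^ 2 - 2 * a * g x + g x ^ 2) / T) μ :=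
    (integrable_const T).add (hi2.div_const T)
  calc ∫ x, |f x - a| ∂μ
      ≤ ∫ x, ((f x - a) + (T + (a ^ 2 - 2 * a * g x + g x ^ 2) / T)) ∂μ :=
        integral_mono hi1.abs (hi1.add hi3) hpt
    _ = T + (a ^ 2 - 2 * a * ∫ x, g x ∂μ + ∫ x, g x ^ 2 ∂μ) / T := by
        rw [integral_add hi1 hi3,
          integral_add (integrable_const T) (hi2.div_const T), integral_div,
          integral_add hi4 hg2,
          integral_sub (integrable_const _) (hg.const_mul _), integral_sub hf (integrable_const a),
          integral_const_mul]
        simp [hfa]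
    _ ≤ _ := by
        have : a ^ 2 - 2 * a * ∫ x, g x ∂μ + ∫ x, g x ^ 2 ∂μ ≤ 2 * a * η + κ := by
          nlinarith
        gcongr _ + ?_ / _

theorem sum_dilate_mul_le {ψ : ℕ → ℝ} (h0 : ∀ q, 1 ≤ q → 0 ≤ ψ q)
    (hψ : ∀ q r, 1 ≤ q → q ≤ r → ψ r ≤ ψ q) {d : ℕ} (hd : 0 < d) (Q : ℕ) :
    (∑ q ∈ Finset.Icc 1 (Q / d), ψ (d * q)) * d ≤ ∑ q ∈ Finset.Icc 1 Q, ψ q := by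
  have key : ∀ m : ℕ, (∑ q ∈ Finset.Icc 1 m, ψ (d * q)) * d ≤ ∑ q ∈ Finset.Icc 1 (d * m), ψ q := by
    intro m
    induction m with
    | zero => simp
    | succ m ih =>
      rw [Finset.sum_Icc_succ_top (by omega), add_mul]
      have h1 : ∑ q ∈ Finset.Icc 1 (d * (m + 1)), ψ q =
          ∑ q ∈ Finset.Icc 1 (d * m), ψ q + ∑ q ∈ Finset.Ioc (d * m) (d * (m + 1)), ψ q := by
        rw [show Finset.Icc 1 (d * (m + 1)) = Finset.Ioc 0 (d * (m + 1)) from rfl,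
          show Finset.Icc 1 (d * m) = Finset.Ioc 0 (d * m) from rfl,
          Finset.sum_Ioc_consecutive _ (Nat.zero_le _) (by nlinarith)]
      rw [h1]
      refine add_le_add ih ?_
      have := Finset.card_nsmul_le_sum (Finset.Ioc (d * m) (d * (m + 1))) ψ (ψ (d * (m + 1)))
        (fun q hq => by
          rw [Finset.mem_Ioc] at hq
          exact hψ _ _ (by omega) hq.2)
      rw [Nat.card_Ioc, show d * (m + 1) - d * m = d by rw [mul_add]; omega, nsmul_eq_mul] at this
      linarith
  refine (key _).trans (Finset.sum_le_sum_of_subset_of_nonneg ?_ ?_)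
  · exact Finset.Icc_subset_Icc_right (Nat.mul_div_le Q d)
  · intro q hq _
    exact h0 q (Finset.mem_Icc.1 hq).1

theorem le_sum_dilate_mul {ψ : ℕ → ℝ} (h0 : ∀ q, 1 ≤ q → 0 ≤ ψ q)
    (hψ : ∀ q r, 1 ≤ q → q ≤ r → ψ r ≤ ψ q) {d : ℕ} (hd : 0 < d) (Q : ℕ) :
    ∑ q ∈ Finset.Icc 1 Q, ψ q ≤ (∑ q ∈ Finset.Icc 1 (Q / d), ψ (d * q)) * d + d * ψ 1 := by
  have key : ∀ m : ℕ, ∑ q ∈ Finset.Ico 1 (d * (m + 1)), ψ q ≤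
      (∑ q ∈ Finset.Icc 1 m, ψ (d * q)) * d + d * ψ 1 := by
    intro m
    induction m with
    | zero =>
      have := Finset.sum_le_card_nsmul (Finset.Ico 1 (d * (0 + 1))) ψ (ψ 1)
        (fun q hq => by
          rw [Finset.mem_Ico] at hq
          exact hψ _ _ le_rfl hq.1)
      rw [Nat.card_Ico, nsmul_eq_mul] at this
      refine this.trans ?_
      have h1 : ((d * (0 + 1) - 1 : ℕ) : ℝ) ≤ d := by exact_mod_cast (by omega)
      have := mul_le_mul_of_nonneg_right h1 (h0 1 le_rfl)
      simpa using this
    | succ m ih =>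
      rw [Finset.sum_Icc_succ_top (by omega), add_mul,
        ← Finset.sum_Ico_consecutive _ (show 1 ≤ d * (m + 1) by nlinarith)
          (show d * (m + 1) ≤ d * (m + 1 + 1) by nlinarith)]
      have := Finset.sum_le_card_nsmul (Finset.Ico (d * (m + 1)) (d * (m + 1 + 1))) ψ
        (ψ (d * (m + 1)))
        (fun q hq => by
          rw [Finset.mem_Ico] at hq
          exact hψ _ _ (by nlinarith) hq.1)
      rw [Nat.card_Ico, show d * (m + 1 + 1) - d * (m + 1) = d by rw [mul_add d (m + 1)]; omega,
        nsmul_eq_mul] at this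
      linarith
  refine (Finset.sum_le_sum_of_subset_of_nonneg ?_ ?_).trans (key (Q / d))
  · intro q hq
    rw [Finset.mem_Icc] at hq
    rw [Finset.mem_Ico]
    have h1 := Nat.div_add_mod Q d
    have h2 := Nat.mod_lt Q hd
    refine ⟨hq.1, ?_⟩
    rw [mul_add]; omega
  · intro q hq _
    exact h0 q (Finset.mem_Ico.1 hq).1

/-- The points `x` with `|q x - p| < ψ q`, for `w = (q, p)`. -/
def nearSet (ψ : ℕ → ℝ) (w : ℕ × ℤ) : Set ℝ := Metric.ball ((w.2 : ℝ) / w.1) (ψ w.1 / w.1)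

theorem measurableSet_nearSet (ψ : ℕ → ℝ) (w : ℕ × ℤ) : MeasurableSet (nearSet ψ w) :=
  measurableSet_ball

theorem mem_nearSet {ψ : ℕ → ℝ} {w : ℕ × ℤ} (hw : 1 ≤ w.1) {x : ℝ} :
    x ∈ nearSet ψ w ↔ |w.1 * x - w.2| < ψ w.1 := by
  have h : (0 : ℝ) < w.1 := by exact_mod_cast hw
  rw [nearSet, Metric.mem_ball, Real.dist_eq, lt_div_iff₀ h]
  nth_rewrite 2 [← abs_of_pos h]
  rw [← abs_mul, sub_mul, div_mul_cancel₀ _ h.ne', mul_comm x]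

/-- Box of candidate pairs `(q, p)`. -/
noncomputable def box (Q : ℕ) (B : ℤ) : Finset (ℕ × ℤ) := Finset.Icc 1 Q ×ˢ Finset.Icc (-B) B

theorem mem_box {Q : ℕ} {B : ℤ} {w : ℕ × ℤ} :
    w ∈ box Q B ↔ (1 ≤ w.1 ∧ w.1 ≤ Q) ∧ (-B ≤ w.2 ∧ w.2 ≤ B) := by
  simp [box]

theorem card_parallel_le {W : Finset (ℕ × ℤ)} {G : ℕ} (hW : ∀ w ∈ W, 1 ≤ w.1 ∧ w.2.gcd w.1 ≤ G)
    {w : ℕ × ℤ} (hw : 1 ≤ w.1) :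
    (W.filter fun v => w.2 * v.1 = v.2 * w.1).card ≤ G := by
  have h := Finset.card_le_card_of_injOn (s := W.filter fun v => w.2 * v.1 = v.2 * w.1)
    (t := Finset.Icc 1 G) (fun v => v.2.gcd v.1) ?_ ?_
  · simpa using h
  · intro v hv
    have hv' := hW v (Finset.mem_filter.1 hv).1
    rw [Finset.mem_coe, Finset.mem_Icc]
    refine ⟨?_, hv'.2⟩
    exact Int.gcd_pos_of_ne_zero_right _ (by have := hv'.1; omega)
  · rintro ⟨r, s⟩ hv ⟨r', s'⟩ hv' hg
    rw [Finset.mem_coe, Finset.mem_filter] at hv hv'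
    have h1 := (hW _ hv.1).1
    have h1' := (hW _ hv'.1).1
    simp only at hv hv' h1 h1' hg
    have hw0 : (w.1 : ℤ) ≠ 0 := by omega
    have hpar : s * r' = s' * r := by
      apply mul_right_cancel₀ hw0
      linear_combination -(r' : ℤ) * hv.2 + (r : ℤ) * hv'.2
    have hrr : r' = r := by
      have e1 : (s * r').gcd ((r : ℤ) * r') = s.gcd r * r' := by
        rw [Int.gcd_mul_right]; simp
      have e2 : (s' * r).gcd ((r' : ℤ) * r) = s'.gcd r' * r := by
        rw [Int.gcd_mul_right]; simp
      rw [hpar, mul_comm (r : ℤ), e2, ← hg] at e1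
      have hpos : 0 < s.gcd r := Int.gcd_pos_of_ne_zero_right _ (by omega)
      exact (Nat.eq_of_mul_eq_mul_left hpos e1).symm
    subst hrr
    have hr0 : (r' : ℤ) ≠ 0 := by omega
    rw [mul_right_cancel₀ hr0 hpar]

section Moments

variable {ψ : ℕ → ℝ} {t : ℝ} {Q : ℕ} {B : ℤ}

theorem measureReal_restrict_nearSet_ne_top (s : Set ℝ) :
    volume.restrict (Set.Ioc t (t + 1)) s ≠ ⊤ := by
  have : IsFiniteMeasure (volume.restrict (Set.Ioc t (t + 1))) := inferInstance
  exact measure_ne_top _ _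

theorem sum_box_measureReal (h0 : ∀ q, 1 ≤ q → 0 ≤ ψ q)
    (hB : ∀ w : ℕ × ℤ, 1 ≤ w.1 → w.1 ≤ Q → ∀ x ∈ Set.Ioc t (t + 1), x ∈ nearSet ψ w →
      w ∈ box Q B) :
    ∑ w ∈ box Q B, (volume.restrict (Set.Ioc t (t + 1))).real (nearSet ψ w) =
      2 * ∑ q ∈ Finset.Icc 1 Q, ψ q := by
  rw [box, Finset.sum_product, Finset.mul_sum]
  refine Finset.sum_congr rfl fun q hq => ?_
  rw [Finset.mem_Icc] at hq
  have h := tsum_restrict_volume_ball t (ψ q) q hq.1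
  rw [tsum_eq_sum (s := Finset.Icc (-B) B)] at h
  · have h2 := congrArg ENNReal.toReal h
    rw [ENNReal.toReal_sum (fun _ _ => measureReal_restrict_nearSet_ne_top _),
      ENNReal.toReal_ofReal (by linarith [h0 q hq.1])] at h2
    exact h2
  · intro p hp
    rw [Measure.restrict_apply measurableSet_ball]
    convert measure_empty (μ := volume)
    rw [Set.eq_empty_iff_forall_notMem]
    rintro x ⟨hx1, hx2⟩
    have := hB (q, p) hq.1 hq.2 x hx2 hx1
    rw [mem_box] at this
    exact hp (Finset.mem_Icc.2 this.2)

theorem sum_box_large_gcd_le (h0 : ∀ q, 1 ≤ q → 0 ≤ ψ q)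
    (hψ : ∀ q r, 1 ≤ q → q ≤ r → ψ r ≤ ψ q) {G : ℕ} (hG : 1 ≤ G) :
    ∑ w ∈ (box Q B).filter (fun w => ¬ w.2.gcd w.1 ≤ G),
        (volume.restrict (Set.Ioc t (t + 1))).real (nearSet ψ w) ≤
      2 * (∑ q ∈ Finset.Icc 1 Q, ψ q) / G := by
  set ν := volume.restrict (Set.Ioc t (t + 1))
  set S : Finset (Σ _ : ℕ, ℕ × ℤ) := (Finset.Ioc G Q).sigma fun g => box (Q / g) B
  set φ : (Σ _ : ℕ, ℕ × ℤ) → ℕ × ℤ := fun z => (z.1 * z.2.1, z.1 * z.2.2)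
  have hsub : (box Q B).filter (fun w => ¬ w.2.gcd w.1 ≤ G) ⊆ S.image φ := by
    rintro ⟨q, p⟩ hw
    rw [Finset.mem_filter, mem_box] at hw
    simp only at hw
    obtain ⟨⟨⟨hq1, hqQ⟩, hp⟩, hg⟩ := hw
    obtain ⟨a, ha⟩ : p.gcd q ∣ q := by exact_mod_cast Int.gcd_dvd_right p (q : ℤ)
    obtain ⟨b, hb⟩ := Int.gcd_dvd_left p (q : ℤ)
    have ha1 : 1 ≤ a := by
      rcases Nat.eq_zero_or_pos a with h | h
      · rw [h] at ha; omega
      · exact h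
    have hgpos : 0 < p.gcd q := by omega
    rw [Finset.mem_image]
    refine ⟨⟨p.gcd q, (a, b)⟩, ?_, ?_⟩
    · simp only [S, Finset.mem_sigma, Finset.mem_Ioc, mem_box]
      refine ⟨⟨by omega, ?_⟩, ⟨ha1, ?_⟩, ?_⟩
      · exact (Nat.le_of_dvd hq1 ⟨a, ha⟩).trans hqQ
      · rw [Nat.le_div_iff_mul_le hgpos]; rw [mul_comm, ← ha]; exact hqQ
      · rw [← abs_le] at hp ⊢
        refine le_trans ?_ hp
        conv_rhs => rw [hb, abs_mul]
        have : (1 : ℤ) ≤ |(p.gcd q : ℤ)| := by rw [Nat.abs_cast]; exact_mod_cast hgpos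
        nlinarith [abs_nonneg b]
    · simp only [φ]
      rw [← ha, ← hb]
  have hS : ∀ z ∈ S, nearSet ψ (φ z) = Metric.ball ((z.2.2 : ℝ) / z.2.1)
      (ψ (z.1 * z.2.1) / z.1 / z.2.1) := by
    rintro ⟨g, q, p⟩ hz
    simp only [S, Finset.mem_sigma, Finset.mem_Ioc, mem_box] at hz
    have : (g : ℝ) ≠ 0 := by exact_mod_cast (by omega)
    simp only [nearSet, φ]
    push_cast
    rw [mul_div_mul_left _ _ this, div_div]
  calc _ ≤ ∑ w ∈ S.image φ, ν.real (nearSet ψ w) :=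
        Finset.sum_le_sum_of_subset_of_nonneg hsub fun _ _ _ => measureReal_nonneg
    _ ≤ ∑ z ∈ S, ν.real (nearSet ψ (φ z)) :=
        Finset.sum_image_le_of_nonneg fun _ _ => measureReal_nonneg
    _ = ∑ z ∈ S, ν.real (Metric.ball ((z.2.2 : ℝ) / z.2.1) (ψ (z.1 * z.2.1) / z.1 / z.2.1)) :=
        Finset.sum_congr rfl fun z hz => by rw [hS z hz]
    _ = ∑ g ∈ Finset.Ioc G Q, ∑ q ∈ Finset.Icc 1 (Q / g), ∑ p ∈ Finset.Icc (-B) B,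
          ν.real (Metric.ball ((p : ℝ) / q) (ψ (g * q) / g / q)) := by
        rw [Finset.sum_sigma]
        refine Finset.sum_congr rfl fun g _ => ?_
        rw [box, Finset.sum_product]
    _ ≤ ∑ g ∈ Finset.Ioc G Q, ∑ q ∈ Finset.Icc 1 (Q / g), 2 * (ψ (g * q) / g) := by
        refine Finset.sum_le_sum fun g hg => Finset.sum_le_sum fun q hq => ?_
        rw [Finset.mem_Ioc] at hg
        rw [Finset.mem_Icc] at hq
        have hn : 0 ≤ ψ (g * q) / g :=
          div_nonneg (h0 _ (Nat.mul_pos (by omega) hq.1)) (Nat.cast_nonneg _)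
        have h := (ENNReal.sum_le_tsum (Finset.Icc (-B) B)).trans_eq
          (tsum_restrict_volume_ball t (ψ (g * q) / g) q hq.1)
        have h2 := ENNReal.toReal_mono ENNReal.ofReal_ne_top h
        rwa [ENNReal.toReal_sum (fun _ _ => measureReal_restrict_nearSet_ne_top _),
          ENNReal.toReal_ofReal (by linarith)] at h2
    _ ≤ ∑ g ∈ Finset.Ioc G Q, 2 * (∑ q ∈ Finset.Icc 1 Q, ψ q) * ((g : ℝ) ^ 2)⁻¹ := by
        refine Finset.sum_le_sum fun g hg => ?_
        rw [Finset.mem_Ioc] at hg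
        have hg0 : (0 : ℝ) < g := by exact_mod_cast (by omega)
        have := sum_dilate_mul_le h0 hψ (show 0 < g by omega) Q
        rw [← Finset.mul_sum, ← Finset.sum_div, mul_assoc, ← div_eq_mul_inv]
        refine mul_le_mul_of_nonneg_left ?_ zero_le_two
        rw [div_le_div_iff₀ hg0 (by positivity)]
        nlinarith
    _ ≤ _ := by
        rw [← Finset.mul_sum, div_eq_mul_inv]
        have hΨ : 0 ≤ ∑ q ∈ Finset.Icc 1 Q, ψ q :=
          Finset.sum_nonneg fun q hq => h0 q (Finset.mem_Icc.1 hq).1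
        gcongr
        rcases le_total G Q with h | h
        · have := sum_Ioc_inv_sq_le_sub (α := ℝ) (show G ≠ 0 by omega) h
          refine this.trans ?_
          simp
        · rw [Finset.Ioc_eq_empty (by omega)]
          simp

theorem sum_box_pairs_le (h0 : ∀ q, 1 ≤ q → 0 ≤ ψ q)
    (hB : ∀ w : ℕ × ℤ, 1 ≤ w.1 → w.1 ≤ Q → ∀ x ∈ Set.Ioc t (t + 1), x ∈ nearSet ψ w →
      w ∈ box Q B) (G : ℕ) :
    ∑ w ∈ (box Q B).filter (fun w => w.2.gcd w.1 ≤ G),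
      ∑ v ∈ (box Q B).filter (fun w => w.2.gcd w.1 ≤ G),
        (volume.restrict (Set.Ioc t (t + 1))).real (nearSet ψ w ∩ nearSet ψ v) ≤
      (2 * ∑ q ∈ Finset.Icc 1 Q, ψ q) ^ 2 + G * (2 * ∑ q ∈ Finset.Icc 1 Q, ψ q) := by
  set ν := volume.restrict (Set.Ioc t (t + 1))
  set W := (box Q B).filter (fun w => w.2.gcd w.1 ≤ G)
  have hW : ∀ w ∈ W, 1 ≤ w.1 ∧ w.2.gcd w.1 ≤ G := fun w hw =>
    ⟨(mem_box.1 (Finset.mem_filter.1 hw).1).1.1, (Finset.mem_filter.1 hw).2⟩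
  have hWb : W ⊆ box Q B := Finset.filter_subset _ _
  have hsplit : ∀ w ∈ W, ∑ v ∈ W, ν.real (nearSet ψ w ∩ nearSet ψ v) ≤
      ∑ v ∈ W, (if w.2 * v.1 ≠ v.2 * w.1 then ν.real (nearSet ψ w ∩ nearSet ψ v) else 0) +
        G * ν.real (nearSet ψ w) := by
    intro w hw
    rw [← Finset.sum_filter, ← Finset.sum_filter_add_sum_filter_not W
      (fun v => w.2 * v.1 ≠ v.2 * w.1)]
    gcongr
    have h1 := Finset.sum_le_card_nsmul (W.filter fun v => ¬ w.2 * v.1 ≠ v.2 * w.1)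
      (fun v => ν.real (nearSet ψ w ∩ nearSet ψ v)) (ν.real (nearSet ψ w))
      (fun v _ => measureReal_mono Set.inter_subset_left)
    refine h1.trans ?_
    rw [nsmul_eq_mul]
    gcongr
    simp only [ne_eq, not_not]
    exact card_parallel_le hW (hW w hw).1
  refine (Finset.sum_le_sum hsplit).trans ?_
  rw [Finset.sum_add_distrib, ← Finset.mul_sum]
  refine add_le_add ?_ (mul_le_mul_of_nonneg_left ?_ (Nat.cast_nonneg _))
  · calc _ ≤ ∑ w ∈ box Q B, ∑ v ∈ box Q B,
          (if w.2 * v.1 ≠ v.2 * w.1 then ν.real (nearSet ψ w ∩ nearSet ψ v) else 0) := by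
          have hnn : ∀ w v : ℕ × ℤ, 0 ≤
              (if w.2 * v.1 ≠ v.2 * w.1 then ν.real (nearSet ψ w ∩ nearSet ψ v) else 0) := by
            intro w v
            split_ifs
            exacts [measureReal_nonneg, le_rfl]
          refine (Finset.sum_le_sum fun w _ => Finset.sum_le_sum_of_subset_of_nonneg hWb
            fun v _ _ => hnn w v).trans
            (Finset.sum_le_sum_of_subset_of_nonneg hWb fun w _ _ =>
              Finset.sum_nonneg fun v _ => hnn w v)
      _ = ∑ q ∈ Finset.Icc 1 Q, ∑ r ∈ Finset.Icc 1 Q,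
          ∑ z ∈ Finset.Icc (-B) B ×ˢ Finset.Icc (-B) B,
          (if z.1 * r ≠ z.2 * q then ν.real (nearSet ψ (q, z.1) ∩ nearSet ψ (r, z.2)) else 0) := by
          simp only [box, Finset.sum_product]
          refine Finset.sum_congr rfl fun q _ => ?_
          rw [Finset.sum_comm]
      _ ≤ ∑ q ∈ Finset.Icc 1 Q, ∑ r ∈ Finset.Icc 1 Q, (2 * ψ q) * (2 * ψ r) := by
          refine Finset.sum_le_sum fun q hq => Finset.sum_le_sum fun r hr => ?_
          rw [Finset.mem_Icc] at hq hr
          have h := (ENNReal.sum_le_tsum (Finset.Icc (-B) B ×ˢ Finset.Icc (-B) B)).trans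
            (tsum_restrict_volume_ball_inter_le t (ψ q) (ψ r) q r hq.1 hr.1)
          have h2 := ENNReal.toReal_mono (by finiteness) h
          rw [ENNReal.toReal_sum, ENNReal.toReal_mul,
            ENNReal.toReal_ofReal (by linarith [h0 q hq.1]),
            ENNReal.toReal_ofReal (by linarith [h0 r hr.1])] at h2
          · refine le_trans (le_of_eq (Finset.sum_congr rfl fun z _ => ?_)) h2
            split_ifs <;> simp [nearSet, Measure.real, ν]
          · intro z _
            split_ifs
            exacts [measureReal_restrict_nearSet_ne_top _, ENNReal.zero_ne_top]
      _ = _ := by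
          rw [sq, Finset.mul_sum, Finset.sum_mul_sum]
  · rw [← sum_box_measureReal h0 hB]
    exact Finset.sum_le_sum_of_subset_of_nonneg hWb fun _ _ _ => measureReal_nonneg

end Moments

section FirstMoment

variable {ψ : ℕ → ℝ} {t : ℝ} {Q : ℕ} {B : ℤ}

theorem integrable_sum_indicator_nearSet (μ : Measure ℝ) [IsFiniteMeasure μ]
    (W : Finset (ℕ × ℤ)) :
    Integrable (fun x => ∑ w ∈ W, (nearSet ψ w).indicator (1 : ℝ → ℝ) x) μ :=
  integrable_finsetSum _ fun w _ =>
    (integrable_const (1 : ℝ)).indicator (measurableSet_nearSet ψ w)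

theorem integral_sum_indicator_nearSet (μ : Measure ℝ) [IsFiniteMeasure μ]
    (W : Finset (ℕ × ℤ)) :
    ∫ x, ∑ w ∈ W, (nearSet ψ w).indicator (1 : ℝ → ℝ) x ∂μ = ∑ w ∈ W, μ.real (nearSet ψ w) := by
  rw [integral_finsetSum (f := fun w => (nearSet ψ w).indicator (1 : ℝ → ℝ)) _ fun w _ =>
    (integrable_const (1 : ℝ)).indicator (measurableSet_nearSet ψ w)]
  exact Finset.sum_congr rfl fun w _ => integral_indicator_one (measurableSet_nearSet ψ w)

theorem sq_sum_indicator_nearSet (W : Finset (ℕ × ℤ)) (x : ℝ) :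
    (∑ w ∈ W, (nearSet ψ w).indicator (1 : ℝ → ℝ) x) ^ 2 =
      ∑ w ∈ W, ∑ v ∈ W, (nearSet ψ w ∩ nearSet ψ v).indicator (1 : ℝ → ℝ) x := by
  rw [sq, Finset.sum_mul_sum]
  refine Finset.sum_congr rfl fun w _ => Finset.sum_congr rfl fun v _ => ?_
  rw [Set.inter_indicator_one, Pi.mul_apply]

theorem integrable_indicator_inter_nearSet (μ : Measure ℝ) [IsFiniteMeasure μ]
    (w v : ℕ × ℤ) :
    Integrable ((nearSet ψ w ∩ nearSet ψ v).indicator (1 : ℝ → ℝ)) μ :=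
  (integrable_const (1 : ℝ)).indicator
    ((measurableSet_nearSet ψ w).inter (measurableSet_nearSet ψ v))

theorem integral_abs_sum_box_sub_le (h0 : ∀ q, 1 ≤ q → 0 ≤ ψ q)
    (hψ : ∀ q r, 1 ≤ q → q ≤ r → ψ r ≤ ψ q)
    (hB : ∀ w : ℕ × ℤ, 1 ≤ w.1 → w.1 ≤ Q → ∀ x ∈ Set.Ioc t (t + 1), x ∈ nearSet ψ w →
      w ∈ box Q B) :
    ∫ x in Set.Ioc t (t + 1), |∑ w ∈ box Q B, (nearSet ψ w).indicator (1 : ℝ → ℝ) x -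
        2 * ∑ q ∈ Finset.Icc 1 Q, ψ q| ≤
      13 * (∑ q ∈ Finset.Icc 1 Q, ψ q) ^ (3 / 4 : ℝ) := by
  set ν := volume.restrict (Set.Ioc t (t + 1)) with hν
  have : IsProbabilityMeasure ν := ⟨by simp [hν]⟩
  have hΨ : 0 ≤ ∑ q ∈ Finset.Icc 1 Q, ψ q :=
    Finset.sum_nonneg fun q hq => h0 q (Finset.mem_Icc.1 hq).1
  have hmean := (integral_sum_indicator_nearSet ν (box Q B)).trans (sum_box_measureReal h0 hB)
  have hint := integrable_sum_indicator_nearSet (ψ := ψ) ν (box Q B)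
  set Ψ := ∑ q ∈ Finset.Icc 1 Q, ψ q
  rcases lt_or_ge Ψ 1 with hlt | hge
  · have hnn : ∀ x, 0 ≤ ∑ w ∈ box Q B, (nearSet ψ w).indicator (1 : ℝ → ℝ) x := fun x =>
      Finset.sum_nonneg fun w _ => Set.indicator_nonneg (fun _ _ => zero_le_one) x
    have h1 : Ψ ≤ Ψ ^ (3 / 4 : ℝ) := by
      rcases hΨ.eq_or_lt with h | h
      · rw [← h]; exact Real.rpow_nonneg le_rfl _
      · exact Real.self_le_rpow_of_le_one hΨ hlt.le (by norm_num)
    calc _ ≤ ∫ x, (∑ w ∈ box Q B, (nearSet ψ w).indicator (1 : ℝ → ℝ) x + 2 * Ψ) ∂ν := by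
          refine integral_mono (hint.sub (integrable_const _)).abs
            (hint.add (integrable_const _)) fun x => ?_
          have := hnn x
          simp only
          rw [abs_le]
          constructor <;> linarith
      _ = 4 * Ψ := by
          rw [integral_add hint (integrable_const _), hmean]
          simp
          ring
      _ ≤ _ := by linarith
  · set G := ⌈√Ψ⌉₊
    have hs1 : 1 ≤ √Ψ := Real.one_le_sqrt.2 hge
    have hG : √Ψ ≤ G := Nat.le_ceil _
    have hG2 : (G : ℝ) ≤ 2 * √Ψ := by
      have := Nat.ceil_lt_add_one (Real.sqrt_nonneg Ψ)
      linarith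
    have hG1 : 1 ≤ G := by exact_mod_cast hs1.trans hG
    set W := (box Q B).filter (fun w => w.2.gcd w.1 ≤ G)
    have hT : 0 < Ψ ^ (3 / 4 : ℝ) := Real.rpow_pos_of_pos (by linarith) _
    have hL := integral_abs_sub_le_of_sq (μ := ν)
      (f := fun x => ∑ w ∈ box Q B, (nearSet ψ w).indicator (1 : ℝ → ℝ) x)
      (g := fun x => ∑ w ∈ W, (nearSet ψ w).indicator (1 : ℝ → ℝ) x)
      (a := 2 * Ψ) (η := 2 * Ψ / G) (κ := G * (2 * Ψ)) (T := Ψ ^ (3 / 4 : ℝ)) hint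
      (integrable_sum_indicator_nearSet ν W) ?_ ?_ (by linarith) hT hmean ?_ ?_
    · refine hL.trans ?_
      have hTT : Ψ ^ (3 / 4 : ℝ) * Ψ ^ (3 / 4 : ℝ) = Ψ * √Ψ := by
        rw [← Real.rpow_add (by linarith), Real.sqrt_eq_rpow]
        nth_rewrite 2 [← Real.rpow_one Ψ]
        rw [← Real.rpow_add (by linarith)]
        norm_num
      have hb : 2 * (2 * Ψ) * (2 * Ψ / G) + G * (2 * Ψ) ≤ 12 * (Ψ * √Ψ) := by
        have hsq : √Ψ * √Ψ = Ψ := Real.mul_self_sqrt hΨ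
        have h1 : Ψ / G ≤ √Ψ := by
          rw [div_le_iff₀ (by linarith)]
          nlinarith
        have h2 : 2 * (2 * Ψ) * (2 * Ψ / G) = 8 * Ψ * (Ψ / G) := by ring
        rw [h2]
        nlinarith
      rw [← hTT] at hb
      have : (2 * (2 * Ψ) * (2 * Ψ / G) + G * (2 * Ψ)) / Ψ ^ (3 / 4 : ℝ) ≤
          12 * Ψ ^ (3 / 4 : ℝ) := by
        rw [div_le_iff₀ hT]; linarith
      linarith
    · simp_rw [sq_sum_indicator_nearSet]
      exact integrable_finsetSum _ fun w _ => integrable_finsetSum _ fun v _ =>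
        integrable_indicator_inter_nearSet ν w v
    · intro x
      exact Finset.sum_le_sum_of_subset_of_nonneg (Finset.filter_subset _ _)
        fun w _ _ => Set.indicator_nonneg (fun _ _ => zero_le_one) x
    · rw [integral_sum_indicator_nearSet]
      have hm := sum_box_measureReal h0 hB
      have hsplit := Finset.sum_filter_add_sum_filter_not (box Q B)
        (fun w => w.2.gcd w.1 ≤ G) (fun w => ν.real (nearSet ψ w))
      have := sum_box_large_gcd_le (t := t) (B := B) (Q := Q) h0 hψ hG1
      linarith
    · simp_rw [sq_sum_indicator_nearSet]
      rw [integral_finsetSum _ fun w _ => integrable_finsetSum _ fun v _ =>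
        integrable_indicator_inter_nearSet ν w v]
      refine le_trans (le_of_eq (Finset.sum_congr rfl fun w _ => ?_))
        (sum_box_pairs_le h0 hB G)
      rw [integral_finsetSum _ fun v _ => integrable_indicator_inter_nearSet ν w v]
      exact Finset.sum_congr rfl fun v _ => integral_indicator_one
        ((measurableSet_nearSet ψ w).inter (measurableSet_nearSet ψ v))

end FirstMoment

/-- The pairs `(q, p)` with `1 ≤ q ≤ Q` and `|q x - p| < ψ q`. -/
def approxPairs (ψ : ℕ → ℝ) (Q : ℕ) (x : ℝ) : Set (ℕ × ℤ) :=
  {w | 1 ≤ w.1 ∧ w.1 ≤ Q ∧ |w.1 * x - w.2| < ψ w.1}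

theorem exists_approxPairs_subset_box {ψ : ℕ → ℝ} (hψ : ∀ q r, 1 ≤ q → q ≤ r → ψ r ≤ ψ q)
    (Q : ℕ) (t : ℝ) : ∃ B : ℤ, ∀ x ∈ Set.Ioc t (t + 1), approxPairs ψ Q x ⊆ box Q B := by
  refine ⟨⌈Q * (|t| + 1) + ψ 1⌉, ?_⟩
  rintro x hx ⟨q, p⟩ ⟨h1, hQ, h⟩
  simp only at h1 hQ h
  rw [Finset.mem_coe, mem_box]
  refine ⟨⟨h1, hQ⟩, ?_⟩
  rw [← abs_le]
  have hx' : |x| ≤ |t| + 1 := by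
    rw [abs_le]
    have := neg_abs_le t
    have := le_abs_self t
    constructor <;> linarith [hx.1, hx.2]
  have hp : |(p : ℝ)| ≤ Q * (|t| + 1) + ψ 1 := by
    have e1 : |(p : ℝ)| ≤ |q * x| + |q * x - p| := by
      have := abs_sub_abs_le_abs_sub (p : ℝ) (q * x)
      rw [abs_sub_comm] at this
      linarith
    have e2 : |q * x| ≤ Q * (|t| + 1) := by
      rw [abs_mul, Nat.abs_cast]
      gcongr
    linarith [hψ 1 q le_rfl h1]
  have : ((|p| : ℤ) : ℝ) ≤ ⌈Q * (|t| + 1) + ψ 1⌉ := by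
    push_cast
    exact hp.trans (Int.le_ceil _)
  exact_mod_cast this

theorem finite_approxPairs {ψ : ℕ → ℝ} (hψ : ∀ q r, 1 ≤ q → q ≤ r → ψ r ≤ ψ q)
    (Q : ℕ) (x : ℝ) : (approxPairs ψ Q x).Finite := by
  obtain ⟨B, hB⟩ := exists_approxPairs_subset_box hψ Q (x - 1)
  exact (Finset.finite_toSet _).subset (hB x ⟨by linarith, by linarith⟩)

theorem ncard_approxPairs_eq_sum {ψ : ℕ → ℝ} {Q : ℕ} {x : ℝ} {B : ℤ}
    (hB : approxPairs ψ Q x ⊆ box Q B) :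
    ((approxPairs ψ Q x).ncard : ℝ) =
      ∑ w ∈ box Q B, (nearSet ψ w).indicator (1 : ℝ → ℝ) x := by
  classical
  have : approxPairs ψ Q x = ((box Q B).filter fun w => x ∈ nearSet ψ w : Finset (ℕ × ℤ)) := by
    ext w
    rw [Finset.mem_coe, Finset.mem_filter]
    constructor
    · intro h
      exact ⟨hB h, (mem_nearSet h.1).2 h.2.2⟩
    · rintro ⟨h1, h2⟩
      have h3 := (mem_box.1 h1).1
      exact ⟨h3.1, h3.2, (mem_nearSet h3.1).1 h2⟩
  rw [this, Set.ncard_coe_finset, Finset.card_filter]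
  push_cast
  exact Finset.sum_congr rfl fun w _ => by simp [Set.indicator]

theorem integral_abs_ncard_approxPairs_sub_le {ψ : ℕ → ℝ} (h0 : ∀ q, 1 ≤ q → 0 ≤ ψ q)
    (hψ : ∀ q r, 1 ≤ q → q ≤ r → ψ r ≤ ψ q) (Q : ℕ) (t : ℝ) :
    IntegrableOn (fun x => ((approxPairs ψ Q x).ncard : ℝ)) (Set.Ioc t (t + 1)) ∧
    ∫ x in Set.Ioc t (t + 1), |((approxPairs ψ Q x).ncard : ℝ) -
        2 * ∑ q ∈ Finset.Icc 1 Q, ψ q| ≤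
      13 * (∑ q ∈ Finset.Icc 1 Q, ψ q) ^ (3 / 4 : ℝ) := by
  obtain ⟨B, hB⟩ := exists_approxPairs_subset_box hψ Q t
  constructor
  · refine IntegrableOn.congr_fun (f := fun x =>
      ∑ w ∈ box Q B, (nearSet ψ w).indicator (1 : ℝ → ℝ) x) ?_ ?_ measurableSet_Ioc
    · exact integrable_sum_indicator_nearSet _ _
    · intro x hx
      exact (ncard_approxPairs_eq_sum (hB x hx)).symm
  · refine le_trans (le_of_eq (setIntegral_congr_fun measurableSet_Ioc fun x hx => ?_))
      (integral_abs_sum_box_sub_le h0 hψ (B := B) ?_)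
    · simp only [ncard_approxPairs_eq_sum (hB x hx)]
    · intro w h1 h2 x hx hw
      exact hB x hx ⟨h1, h2, (mem_nearSet h1).1 hw⟩

/-- The coprime pairs `(q, p)` with `1 ≤ q ≤ Q` and `|q x - p| < ψ q`. -/
def primitivePairs (ψ : ℕ → ℝ) (Q : ℕ) (x : ℝ) : Set (ℕ × ℤ) :=
  {w | w ∈ approxPairs ψ Q x ∧ w.2.gcd w.1 = 1}

open scoped ArithmeticFunction.Moebius ArithmeticFunction.zeta in
theorem sum_divisors_moebius_real (n : ℕ) :
    ∑ d ∈ n.divisors, (μ d : ℝ) = if n = 1 then 1 else 0 := by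
  have h := congrArg (fun f : ArithmeticFunction ℤ => f n) ArithmeticFunction.moebius_mul_coe_zeta
  simp only [ArithmeticFunction.coe_mul_zeta_apply, ArithmeticFunction.one_apply] at h
  exact_mod_cast h

theorem image_approxPairs_dilate (ψ : ℕ → ℝ) (Q : ℕ) (x : ℝ) {d : ℕ} (hd : 0 < d) :
    (fun w : ℕ × ℤ => (d * w.1, (d : ℤ) * w.2)) ''
        approxPairs (fun q => ψ (d * q) / d) (Q / d) x =
      {w | w ∈ approxPairs ψ Q x ∧ d ∣ w.2.gcd w.1} := by
  have hd0 : (0 : ℝ) < d := by exact_mod_cast hd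
  have key : ∀ (q : ℕ) (p : ℤ), |((d * q : ℕ) : ℝ) * x - ((d * p : ℤ) : ℝ)| < ψ (d * q) ↔
      |q * x - p| < ψ (d * q) / d := by
    intro q p
    push_cast
    rw [mul_assoc, ← mul_sub, abs_mul, abs_of_pos hd0, lt_div_iff₀ hd0, mul_comm]
  ext ⟨q, p⟩
  constructor
  · rintro ⟨⟨q', p'⟩, ⟨h1, h2, h3⟩, h⟩
    simp only [Prod.mk.injEq] at h
    obtain ⟨rfl, rfl⟩ := h
    simp only at h1 h2 h3
    refine ⟨⟨Nat.mul_pos hd h1, ?_, (key q' p').2 h3⟩, ?_⟩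
    · simp only
      rw [mul_comm]
      exact (Nat.le_div_iff_mul_le hd).1 h2
    · refine Int.dvd_gcd ?_ ?_
      · exact Dvd.intro _ rfl
      · push_cast; exact Dvd.intro _ rfl
  · rintro ⟨⟨h1, h2, h3⟩, h⟩
    simp only at h1 h2 h3 h
    obtain ⟨p', rfl⟩ : (d : ℤ) ∣ p := (Int.natCast_dvd_natCast.2 h).trans (Int.gcd_dvd_left _ _)
    obtain ⟨q', rfl⟩ : d ∣ q := by
      exact_mod_cast (Int.natCast_dvd_natCast.2 h).trans (Int.gcd_dvd_right _ _)
    refine ⟨(q', p'), ⟨?_, ?_, (key q' p').1 h3⟩, rfl⟩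
    · exact Nat.pos_of_mul_pos_left h1
    · rw [Nat.le_div_iff_mul_le hd, mul_comm]; exact h2

open scoped ArithmeticFunction.Moebius in
theorem ncard_primitivePairs {ψ : ℕ → ℝ} (hψ : ∀ q r, 1 ≤ q → q ≤ r → ψ r ≤ ψ q)
    (Q : ℕ) (x : ℝ) :
    ((primitivePairs ψ Q x).ncard : ℝ) = ∑ d ∈ Finset.Icc 1 Q,
      (μ d : ℝ) * (approxPairs (fun q => ψ (d * q) / d) (Q / d) x).ncard := by
  classical
  set A := (finite_approxPairs hψ Q x).toFinset
  have hA : ∀ w, w ∈ A ↔ w ∈ approxPairs ψ Q x := fun w => Set.Finite.mem_toFinset _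
  have h1 : primitivePairs ψ Q x = (A.filter fun w => w.2.gcd w.1 = 1 : Finset (ℕ × ℤ)) := by
    ext w
    rw [Finset.mem_coe, Finset.mem_filter, hA]
    rfl
  have h2 : ∀ d ∈ Finset.Icc 1 Q, (approxPairs (fun q => ψ (d * q) / d) (Q / d) x).ncard =
      (A.filter fun w => d ∣ w.2.gcd w.1).card := by
    intro d hd
    have hd1 : 0 < d := (Finset.mem_Icc.1 hd).1
    rw [← Set.ncard_coe_finset, ← Set.ncard_image_of_injective _
      (f := fun w : ℕ × ℤ => (d * w.1, (d : ℤ) * w.2)) ?_, image_approxPairs_dilate ψ Q x hd1]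
    · congr 1
      ext w
      rw [Finset.mem_coe, Finset.mem_filter, hA]
      rfl
    · rintro ⟨a, b⟩ ⟨a', b'⟩ h
      simp only [Prod.mk.injEq] at h
      have hdz : (d : ℤ) ≠ 0 := by omega
      rw [Nat.eq_of_mul_eq_mul_left hd1 h.1, mul_left_cancel₀ hdz h.2]
  rw [h1, Set.ncard_coe_finset, Finset.sum_congr rfl fun d hd => by rw [h2 d hd]]
  simp only [Finset.card_filter]
  push_cast
  simp_rw [Finset.mul_sum]
  rw [Finset.sum_comm]
  refine Finset.sum_congr rfl fun w hw => ?_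
  obtain ⟨hw1, hwQ, -⟩ := (hA w).1 hw
  rw [← sum_divisors_moebius_real]
  have hg : 0 < w.2.gcd w.1 := Int.gcd_pos_of_ne_zero_right _ (by omega)
  have hgw : w.2.gcd w.1 ≤ w.1 :=
    Nat.le_of_dvd hw1 (by exact_mod_cast Int.gcd_dvd_right w.2 (w.1 : ℤ))
  simp_rw [mul_ite, mul_one, mul_zero]
  rw [← Finset.sum_filter]
  refine Finset.sum_congr ?_ fun _ _ => rfl
  ext d
  rw [Nat.mem_divisors, Finset.mem_filter, Finset.mem_Icc]
  constructor
  · rintro ⟨h, -⟩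
    exact ⟨⟨Nat.pos_of_dvd_of_pos h hg, (Nat.le_of_dvd hg h).trans (hgw.trans hwQ)⟩, h⟩
  · rintro ⟨-, h⟩
    exact ⟨h, hg.ne'⟩

open scoped ArithmeticFunction.Moebius in
/-- The mean over a unit interval of the number of primitive pairs. -/
noncomputable def primitiveMean (ψ : ℕ → ℝ) (Q : ℕ) : ℝ :=
  ∑ d ∈ Finset.Icc 1 Q, (μ d : ℝ) * (2 * ∑ q ∈ Finset.Icc 1 (Q / d), ψ (d * q) / d)

theorem abs_moebius_real_le_one (d : ℕ) : |(ArithmeticFunction.moebius d : ℝ)| ≤ 1 := by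
  exact_mod_cast ArithmeticFunction.abs_moebius_le_one (n := d)

theorem sum_dilate_le {ψ : ℕ → ℝ} (h0 : ∀ q, 1 ≤ q → 0 ≤ ψ q)
    (hψ : ∀ q r, 1 ≤ q → q ≤ r → ψ r ≤ ψ q) {d : ℕ} (hd : 0 < d) (Q : ℕ) :
    ∑ q ∈ Finset.Icc 1 (Q / d), ψ (d * q) / d ≤ (∑ q ∈ Finset.Icc 1 Q, ψ q) / (d : ℝ) ^ 2 := by
  have hd0 : (0 : ℝ) < d := by exact_mod_cast hd
  rw [← Finset.sum_div, div_le_div_iff₀ hd0 (by positivity)]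
  nlinarith [sum_dilate_mul_le h0 hψ hd Q]

theorem exists_integral_abs_primitive_sub_le {ψ : ℕ → ℝ} (h0 : ∀ q, 1 ≤ q → 0 ≤ ψ q)
    (hψ : ∀ q r, 1 ≤ q → q ≤ r → ψ r ≤ ψ q) (t : ℝ) :
    (∀ Q, IntegrableOn (fun x => ((primitivePairs ψ Q x).ncard : ℝ)) (Set.Ioc t (t + 1))) ∧
    ∃ C : ℝ, 0 ≤ C ∧ ∀ Q, ∫ x in Set.Ioc t (t + 1),
      |((primitivePairs ψ Q x).ncard : ℝ) - primitiveMean ψ Q| ≤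
        C * (∑ q ∈ Finset.Icc 1 Q, ψ q) ^ (3 / 4 : ℝ) := by
  have hd0 : ∀ d : ℕ, ∀ q, 1 ≤ q → 0 ≤ ψ (d * q) / d := by
    intro d q hq
    rcases Nat.eq_zero_or_pos d with rfl | h
    · simp
    · exact div_nonneg (h0 _ (Nat.mul_pos h hq)) (Nat.cast_nonneg _)
  have hdψ : ∀ d : ℕ, ∀ q r, 1 ≤ q → q ≤ r → ψ (d * r) / d ≤ ψ (d * q) / d := by
    intro d q r hq hqr
    rcases Nat.eq_zero_or_pos d with rfl | h
    · simp
    · exact div_le_div_of_nonneg_right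
        (hψ _ _ (Nat.mul_pos h hq) (Nat.mul_le_mul_left d hqr)) (Nat.cast_nonneg _)
  have hI := fun d Q => integral_abs_ncard_approxPairs_sub_le (hd0 d) (hdψ d) Q t
  have hsum : Summable fun d : ℕ => ((d : ℝ) ^ (3 / 2 : ℝ))⁻¹ :=
    Real.summable_nat_rpow_inv.2 (by norm_num)
  refine ⟨fun Q => ?_, 13 * ∑' d : ℕ, ((d : ℝ) ^ (3 / 2 : ℝ))⁻¹,
    mul_nonneg (by norm_num) (tsum_nonneg fun d => by positivity), fun Q => ?_⟩
  · simp_rw [ncard_primitivePairs hψ]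
    exact integrable_finsetSum _ fun d _ => (hI d (Q / d)).1.const_mul _
  · have hΨ : 0 ≤ ∑ q ∈ Finset.Icc 1 Q, ψ q :=
      Finset.sum_nonneg fun q hq => h0 q (Finset.mem_Icc.1 hq).1
    set Ψ := ∑ q ∈ Finset.Icc 1 Q, ψ q
    have hint : ∀ d, IntegrableOn (fun x => |((approxPairs (fun q => ψ (d * q) / d) (Q / d)
        x).ncard : ℝ) - 2 * ∑ q ∈ Finset.Icc 1 (Q / d), ψ (d * q) / d|) (Set.Ioc t (t + 1)) :=
      fun d => ((hI d (Q / d)).1.sub (integrable_const _)).abs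
    calc ∫ x in Set.Ioc t (t + 1), |((primitivePairs ψ Q x).ncard : ℝ) - primitiveMean ψ Q|
        ≤ ∫ x in Set.Ioc t (t + 1), ∑ d ∈ Finset.Icc 1 Q,
          |((approxPairs (fun q => ψ (d * q) / d) (Q / d) x).ncard : ℝ) -
            2 * ∑ q ∈ Finset.Icc 1 (Q / d), ψ (d * q) / d| := by
          refine integral_mono_of_nonneg (Eventually.of_forall fun _ => abs_nonneg _)
            (integrable_finsetSum _ fun d _ => hint d) (Eventually.of_forall fun x => ?_)
          simp only
          rw [ncard_primitivePairs hψ, primitiveMean, ← Finset.sum_sub_distrib]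
          refine (Finset.abs_sum_le_sum_abs _ _).trans (Finset.sum_le_sum fun d _ => ?_)
          rw [← mul_sub, abs_mul]
          exact mul_le_of_le_one_left (abs_nonneg _) (abs_moebius_real_le_one d)
      _ = ∑ d ∈ Finset.Icc 1 Q, ∫ x in Set.Ioc t (t + 1),
          |((approxPairs (fun q => ψ (d * q) / d) (Q / d) x).ncard : ℝ) -
            2 * ∑ q ∈ Finset.Icc 1 (Q / d), ψ (d * q) / d| :=
          integral_finsetSum _ fun d _ => hint d
      _ ≤ ∑ d ∈ Finset.Icc 1 Q, 13 * Ψ ^ (3 / 4 : ℝ) * ((d : ℝ) ^ (3 / 2 : ℝ))⁻¹ := by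
          refine Finset.sum_le_sum fun d hd => (hI d (Q / d)).2.trans ?_
          have hd1 : 0 < d := (Finset.mem_Icc.1 hd).1
          rw [mul_assoc]
          refine mul_le_mul_of_nonneg_left ?_ (by norm_num)
          have h1 := Real.rpow_le_rpow (z := 3 / 4)
            (Finset.sum_nonneg fun q hq => hd0 d q (Finset.mem_Icc.1 hq).1)
            (sum_dilate_le h0 hψ hd1 Q) (by norm_num)
          refine h1.trans (le_of_eq ?_)
          rw [Real.div_rpow hΨ (by positivity), div_eq_mul_inv, ← Real.rpow_natCast,
            ← Real.rpow_mul (Nat.cast_nonneg _)]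
          norm_num
      _ ≤ _ := by
          rw [← Finset.mul_sum]
          have := hsum.sum_le_tsum (Finset.Icc 1 Q) fun d _ => by positivity
          have hn : 0 ≤ Ψ ^ (3 / 4 : ℝ) := Real.rpow_nonneg hΨ _
          nlinarith

open scoped ArithmeticFunction.Moebius in
theorem tendsto_primitiveMean_div {ψ : ℕ → ℝ} (h0 : ∀ q, 1 ≤ q → 0 ≤ ψ q)
    (hψ : ∀ q r, 1 ≤ q → q ≤ r → ψ r ≤ ψ q)
    (hdiv : Tendsto (fun Q => ∑ q ∈ Finset.Icc 1 Q, ψ q) atTop atTop) :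
    Tendsto (fun Q => primitiveMean ψ Q / ∑ q ∈ Finset.Icc 1 Q, ψ q) atTop
      (nhds (2 * ∑' d : ℕ, (μ d : ℝ) / (d : ℝ) ^ 2)) := by
  set Ψ : ℕ → ℝ := fun Q => ∑ q ∈ Finset.Icc 1 Q, ψ q with hΨdef
  set F : ℕ → ℕ → ℝ := fun Q d => if d ∈ Finset.Icc 1 Q then
    (μ d : ℝ) * (2 * ∑ q ∈ Finset.Icc 1 (Q / d), ψ (d * q) / d) / Ψ Q else 0
  have hF : ∀ Q, primitiveMean ψ Q / Ψ Q = ∑' d, F Q d := by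
    intro Q
    rw [tsum_eq_sum (s := Finset.Icc 1 Q) fun d hd => if_neg hd, primitiveMean, Finset.sum_div]
    exact Finset.sum_congr rfl fun d hd => (if_pos hd).symm
  change Tendsto (fun Q => primitiveMean ψ Q / Ψ Q) atTop _
  simp_rw [hF]
  rw [← tsum_mul_left]
  have hΨnn : ∀ Q, 0 ≤ Ψ Q := fun Q =>
    Finset.sum_nonneg fun q hq => h0 q (Finset.mem_Icc.1 hq).1
  refine tendsto_tsum_of_dominated_convergence (bound := fun d : ℕ => 2 * ((d : ℝ) ^ 2)⁻¹)
    ((Real.summable_nat_pow_inv.2 (by norm_num)).mul_left 2) ?_ ?_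
  · intro d
    rcases Nat.eq_zero_or_pos d with rfl | hd
    · simp [F]
    · have hd0 : (0 : ℝ) < d := by exact_mod_cast hd
      have hlim : Tendsto (fun Q => (∑ q ∈ Finset.Icc 1 (Q / d), ψ (d * q) / d) / Ψ Q) atTop
          (nhds (((d : ℝ) ^ 2)⁻¹)) := by
        have hlow : Tendsto (fun Q => (((d : ℝ) ^ 2)⁻¹) - (ψ 1 / d) / Ψ Q) atTop
            (nhds (((d : ℝ) ^ 2)⁻¹ - 0)) :=
          tendsto_const_nhds.sub (hdiv.const_div_atTop _)
        rw [sub_zero] at hlow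
        refine tendsto_of_tendsto_of_tendsto_of_le_of_le' hlow tendsto_const_nhds ?_ ?_
        · filter_upwards [hdiv.eventually_gt_atTop 0] with Q hQ
          have h := le_sum_dilate_mul h0 hψ hd Q
          have hQ' : 0 < Ψ Q := hQ
          rw [le_div_iff₀ hQ', sub_mul, div_mul_cancel₀ _ hQ'.ne', ← Finset.sum_div,
            sub_le_iff_le_add, ← add_div, inv_mul_eq_div, div_le_div_iff₀ (by positivity) hd0]
          change Ψ Q ≤ _ at h
          nlinarith
        · filter_upwards [hdiv.eventually_gt_atTop 0] with Q hQ
          have hQ' : 0 < Ψ Q := hQ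
          rw [div_le_iff₀ hQ', inv_mul_eq_div]
          exact sum_dilate_le h0 hψ hd Q
      have h2 := (hlim.const_mul (2 * (μ d : ℝ)))
      have e : 2 * ((μ d : ℝ) / (d : ℝ) ^ 2) = 2 * (μ d : ℝ) * ((d : ℝ) ^ 2)⁻¹ := by ring
      rw [e]
      refine h2.congr' ?_
      filter_upwards [eventually_ge_atTop d] with Q hQ
      simp only [F]
      rw [if_pos (Finset.mem_Icc.2 ⟨hd, hQ⟩)]
      ring
  · refine Eventually.of_forall fun Q d => ?_
    simp only [F]
    split_ifs with hd
    · have hd1 : 0 < d := (Finset.mem_Icc.1 hd).1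
      have hS : 0 ≤ ∑ q ∈ Finset.Icc 1 (Q / d), ψ (d * q) / d := Finset.sum_nonneg fun q hq =>
        div_nonneg (h0 _ (Nat.mul_pos hd1 (Finset.mem_Icc.1 hq).1)) (Nat.cast_nonneg _)
      have hle := sum_dilate_le h0 hψ hd1 Q
      rw [Real.norm_eq_abs, abs_div, abs_mul, abs_of_nonneg (hΨnn Q),
        abs_of_nonneg (mul_nonneg zero_le_two hS)]
      refine div_le_of_le_mul₀ (hΨnn Q) (by positivity) ?_
      calc _ ≤ 1 * (2 * ∑ q ∈ Finset.Icc 1 (Q / d), ψ (d * q) / d) := by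
            gcongr
            exact abs_moebius_real_le_one d
        _ ≤ 1 * (2 * (Ψ Q / (d : ℝ) ^ 2)) := by gcongr
        _ = _ := by ring
    · rw [norm_zero]; positivity

open scoped ArithmeticFunction.Moebius in
theorem tsum_moebius_div_sq :
    ∑' d : ℕ, (μ d : ℝ) / (d : ℝ) ^ 2 = (∑' m : ℕ, (1 : ℝ) / ((m : ℝ) + 1) ^ 2)⁻¹ := by
  have h := ArithmeticFunction.LSeries_zeta_mul_Lseries_moebius (s := 2) (by norm_num)
  have hz : LSeries (fun n => (ArithmeticFunction.zeta n : ℂ)) 2 =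
      ((∑' m : ℕ, (1 : ℝ) / ((m : ℝ) + 1) ^ 2 : ℝ) : ℂ) := by
    have hs : Summable fun m : ℕ => (1 : ℝ) / (m : ℝ) ^ 2 :=
      Real.summable_one_div_nat_pow.2 (by norm_num)
    have h1 := hs.tsum_eq_zero_add
    push_cast at h1
    rw [show (1 : ℝ) / (0 : ℝ) ^ 2 = 0 by norm_num, zero_add] at h1
    rw [← h1, Complex.ofReal_tsum]
    refine tsum_congr fun n => ?_
    rcases Nat.eq_zero_or_pos n with rfl | hn
    · simp
    · rw [LSeries.term_of_ne_zero hn.ne']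
      simp [ArithmeticFunction.zeta_apply, hn.ne']
  have hm : LSeries (fun n => (μ n : ℂ)) 2 = ((∑' d : ℕ, (μ d : ℝ) / (d : ℝ) ^ 2 : ℝ) : ℂ) := by
    rw [Complex.ofReal_tsum]
    refine tsum_congr fun n => ?_
    rcases Nat.eq_zero_or_pos n with rfl | hn
    · simp
    · rw [LSeries.term_of_ne_zero hn.ne']
      simp
  rw [hz, hm, ← Complex.ofReal_mul] at h
  have h' : (∑' m : ℕ, (1 : ℝ) / ((m : ℝ) + 1) ^ 2) * ∑' d : ℕ, (μ d : ℝ) / (d : ℝ) ^ 2 = 1 := by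
    exact_mod_cast h
  exact eq_inv_of_mul_eq_one_right h'

theorem ae_tendsto_zero_of_summable_integral_abs {Ω : Type*} [MeasurableSpace Ω] {μ : Measure Ω}
    {g : ℕ → Ω → ℝ} (hg : ∀ k, Integrable (g k) μ) (hs : Summable fun k => ∫ x, |g k x| ∂μ) :
    ∀ᵐ x ∂μ, Tendsto (fun k => g k x) atTop (nhds 0) := by
  have hm : ∀ k, AEMeasurable (fun x => ‖g k x‖ₑ) μ := fun k => (hg k).aestronglyMeasurable.enorm
  have hfin : ∫⁻ x, ∑' k, ‖g k x‖ₑ ∂μ ≠ ∞ := by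
    rw [lintegral_tsum hm]
    simp_rw [← fun k => ofReal_integral_norm_eq_lintegral_enorm (hg k)]
    exact hs.tsum_ofReal_ne_top
  filter_upwards [ae_lt_top' (AEMeasurable.tsum hm) hfin] with x hx
  exact tendsto_zero_iff_enorm_tendsto_zero.2 (ENNReal.tendsto_atTop_zero_of_tsum_ne_top hx.ne)

theorem tendsto_div_of_tendsto_subseq {a u : ℕ → ℝ} {n : ℕ → ℕ} {c : ℝ} (hu : Monotone u)
    (hu0 : ∀ m, 0 ≤ u m) (hlim : Tendsto a atTop atTop)
    (hn : ∀ m k : ℕ, (k : ℝ) ^ 8 ≤ a m → n k ≤ m) (hn' : ∀ k : ℕ, (k : ℝ) ^ 8 ≤ a (n k))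
    (ham : Monotone a)
    (hc : Tendsto (fun k : ℕ => u (n k) / (k : ℝ) ^ 8) atTop (nhds c)) :
    Tendsto (fun m => u m / a m) atTop (nhds c) := by
  set K : ℕ → ℕ := fun m => ⌊(a m) ^ (1 / 8 : ℝ)⌋₊ with hK
  have hKlim : Tendsto K atTop atTop :=
    tendsto_nat_floor_atTop.comp ((tendsto_rpow_atTop (by norm_num)).comp hlim)
  have hratio : Tendsto (fun k : ℕ => (k : ℝ) / ((k : ℝ) + 1)) atTop (nhds 1) :=
    tendsto_natCast_div_add_atTop (1 : ℝ)
  have hlow : Tendsto (fun k : ℕ => u (n k) / (k : ℝ) ^ 8 * ((k : ℝ) / (k + 1)) ^ 8) atTop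
      (nhds c) := by
    simpa using hc.mul (hratio.pow 8)
  have hupp : Tendsto (fun k : ℕ => u (n (k + 1)) / ((k + 1 : ℕ) : ℝ) ^ 8 *
      (((k : ℝ) / (k + 1)) ^ 8)⁻¹) atTop (nhds c) := by
    simpa using (hc.comp (tendsto_add_atTop_nat 1)).mul ((hratio.pow 8).inv₀ (by norm_num))
  refine tendsto_of_tendsto_of_tendsto_of_le_of_le' (hlow.comp hKlim) (hupp.comp hKlim) ?_ ?_
  all_goals
    filter_upwards [hKlim.eventually_ge_atTop 1, hlim.eventually_gt_atTop 0] with m hm ha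
    have hk : (0 : ℝ) < K m := by exact_mod_cast hm
    have hroot : ((a m) ^ (1 / 8 : ℝ)) ^ 8 = a m := by
      rw [← Real.rpow_natCast, ← Real.rpow_mul ha.le]
      norm_num
    have hrn : 0 ≤ (a m) ^ (1 / 8 : ℝ) := Real.rpow_nonneg ha.le _
    have hle : (K m : ℝ) ^ 8 ≤ a m := by
      rw [← hroot]
      exact pow_le_pow_left₀ hk.le (Nat.floor_le hrn) 8
    have hlt : a m < ((K m : ℝ) + 1) ^ 8 := by
      rw [← hroot]
      exact pow_lt_pow_left₀ (Nat.lt_floor_add_one _) hrn (by norm_num)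
  · have h1 := hu (hn m (K m) hle)
    simp only [Function.comp]
    rw [div_pow, div_mul_div_cancel₀ (by positivity)]
    exact div_le_div₀ (hu0 _) h1 ha hlt.le
  · have h1 : m ≤ n (K m + 1) := by
      by_contra! h
      have := (hn' (K m + 1)).trans (ham h.le)
      push_cast at this
      linarith
    simp only [Function.comp]
    rw [div_pow, inv_div, Nat.cast_add_one, div_mul_div_cancel₀ (by positivity)]
    exact div_le_div₀ (hu0 _) (hu h1) (by positivity) hle

theorem ae_tendsto_div_of_integral_abs_sub_le {Ω : Type*} [MeasurableSpace Ω] {μ : Measure Ω}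
    [IsFiniteMeasure μ] {f : ℕ → Ω → ℝ} {a M : ℕ → ℝ} {b c C : ℝ}
    (hf : ∀ m, Integrable (f m) μ) (hf0 : ∀ m x, 0 ≤ f m x) (hfm : ∀ x, Monotone fun m => f m x)
    (ha : Monotone a) (ha0 : a 0 = 0) (hab : ∀ m, a (m + 1) ≤ a m + b) (hC : 0 ≤ C)
    (hlim : Tendsto a atTop atTop)
    (hM : Tendsto (fun m => M m / a m) atTop (nhds c))
    (hI : ∀ m, ∫ x, |f m x - M m| ∂μ ≤ C * (a m) ^ (3 / 4 : ℝ)) :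
    ∀ᵐ x ∂μ, Tendsto (fun m => f m x / a m) atTop (nhds c) := by
  have hex : ∀ k : ℕ, ∃ m, (k : ℝ) ^ 8 ≤ a m := fun k => (hlim.eventually_ge_atTop _).exists
  classical
  set n : ℕ → ℕ := fun k => Nat.find (hex k)
  have hn' : ∀ k : ℕ, (k : ℝ) ^ 8 ≤ a (n k) := fun k => Nat.find_spec (hex k)
  have hn : ∀ m k : ℕ, (k : ℝ) ^ 8 ≤ a m → n k ≤ m := fun m k h => Nat.find_min' (hex k) h
  have hb : 0 ≤ b := by linarith [hab 0, ha (Nat.le_succ 0)]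
  have hup : ∀ k : ℕ, 1 ≤ k → a (n k) ≤ (k : ℝ) ^ 8 + b := by
    intro k hk
    have hk' : (1 : ℝ) ≤ k := by exact_mod_cast hk
    rcases Nat.eq_zero_or_pos (n k) with h | h
    · rw [h, ha0]
      positivity
    · have h2 : a (n k - 1) < (k : ℝ) ^ 8 := not_le.1 (Nat.find_min (hex k) (Nat.sub_lt h one_pos))
      have h3 := hab (n k - 1)
      rw [Nat.sub_add_cancel h] at h3
      linarith
  have hk8 : Tendsto (fun k : ℕ => (k : ℝ) ^ 8) atTop atTop :=
    (tendsto_pow_atTop (by norm_num)).comp tendsto_natCast_atTop_atTop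
  have hratio : Tendsto (fun k : ℕ => a (n k) / (k : ℝ) ^ 8) atTop (nhds 1) := by
    have hu : Tendsto (fun k : ℕ => 1 + b / (k : ℝ) ^ 8) atTop (nhds 1) := by
      simpa using (hk8.const_div_atTop b).const_add 1
    refine tendsto_of_tendsto_of_tendsto_of_le_of_le' tendsto_const_nhds hu ?_ ?_
    all_goals
      filter_upwards [eventually_ge_atTop 1] with k hk
      have hk' : (0 : ℝ) < k := by exact_mod_cast hk
    · rw [le_div_iff₀ (by positivity), one_mul]
      exact hn' k
    · rw [div_le_iff₀ (by positivity), add_mul, div_mul_cancel₀ _ (by positivity), one_mul]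
      exact hup k hk
  have hnlim : Tendsto n atTop atTop := by
    refine tendsto_atTop.2 fun N => ?_
    filter_upwards [hk8.eventually_gt_atTop (a N)] with k hk
    by_contra! h
    linarith [hn' k, ha h.le]
  have hMn : Tendsto (fun k : ℕ => M (n k) / (k : ℝ) ^ 8) atTop (nhds c) := by
    have h := (hM.comp hnlim).mul hratio
    rw [mul_one] at h
    refine h.congr' ?_
    filter_upwards [eventually_ge_atTop 1] with k hk
    have hk' : (0 : ℝ) < (k : ℝ) ^ 8 := by positivity
    exact div_mul_div_cancel₀ (hk'.trans_le (hn' k)).ne'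
  have hint : ∀ k, Integrable (fun x => (f (n k) x - M (n k)) / (k : ℝ) ^ 8) μ := fun k =>
    ((hf _).sub (integrable_const _)).div_const _
  have hsum : Summable fun k : ℕ => ∫ x, |(f (n k) x - M (n k)) / (k : ℝ) ^ 8| ∂μ := by
    refine Summable.of_nonneg_of_le (fun k => integral_nonneg fun x => abs_nonneg _) (fun k => ?_)
      ((Real.summable_nat_pow_inv.2 one_lt_two).mul_left (C * (1 + b) ^ (3 / 4 : ℝ)))
    rcases Nat.eq_zero_or_pos k with rfl | hk
    · simp
    have hk' : (1 : ℝ) ≤ k := by exact_mod_cast hk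
    have hk0 : (0 : ℝ) < k := by linarith
    simp_rw [abs_div, abs_of_pos (pow_pos hk0 8)]
    rw [integral_div, div_le_iff₀ (by positivity)]
    refine (hI _).trans ?_
    have h1 : a (n k) ≤ (1 + b) * (k : ℝ) ^ 8 := by
      nlinarith [hup k hk, one_le_pow₀ hk' (n := 8)]
    have h2 : (a (n k)) ^ (3 / 4 : ℝ) ≤ (1 + b) ^ (3 / 4 : ℝ) * (k : ℝ) ^ 6 := by
      refine (Real.rpow_le_rpow (le_trans (by positivity) (hn' k)) h1 (by norm_num)).trans
        (le_of_eq ?_)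
      rw [Real.mul_rpow (by linarith) (by positivity), ← Real.rpow_natCast, ← Real.rpow_mul hk0.le,
        ← Real.rpow_natCast]
      norm_num
    refine (mul_le_mul_of_nonneg_left h2 hC).trans (le_of_eq ?_)
    field_simp
  filter_upwards [ae_tendsto_zero_of_summable_integral_abs hint hsum] with x hx
  refine tendsto_div_of_tendsto_subseq (n := n) (hfm x) (fun m => hf0 m x) hlim hn hn' ha ?_
  have h := hx.add hMn
  rw [zero_add] at h
  refine h.congr fun k => ?_
  ring

theorem ae_tendsto_ncard_primitivePairs_div {ψ : ℕ → ℝ} (h0 : ∀ q, 1 ≤ q → 0 ≤ ψ q)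
    (hψ : ∀ q r, 1 ≤ q → q ≤ r → ψ r ≤ ψ q)
    (hdiv : Tendsto (fun Q => ∑ q ∈ Finset.Icc 1 Q, ψ q) atTop atTop) :
    ∀ᵐ x : ℝ, Tendsto (fun Q => ((primitivePairs ψ Q x).ncard : ℝ) / ∑ q ∈ Finset.Icc 1 Q, ψ q)
      atTop (nhds (2 * (∑' m : ℕ, (1 : ℝ) / ((m : ℝ) + 1) ^ 2)⁻¹)) := by
  rw [← Measure.restrict_univ (μ := volume), ← iUnion_Ioc_intCast ℝ, ae_restrict_iUnion_iff]
  intro t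
  obtain ⟨hint, C, hC, hI⟩ := exists_integral_abs_primitive_sub_le h0 hψ (t : ℝ)
  have hM := tendsto_primitiveMean_div h0 hψ hdiv
  rw [tsum_moebius_div_sq] at hM
  refine ae_tendsto_div_of_integral_abs_sub_le (b := ψ 1) hint (fun _ _ => Nat.cast_nonneg _)
    (fun x Q R hQR => Nat.cast_le.2 (Set.ncard_le_ncard ?_ ((finite_approxPairs hψ R x).subset
      fun w hw => hw.1))) ?_ (by simp) ?_ hC hdiv hM hI
  · exact fun w hw => ⟨⟨hw.1.1, hw.1.2.1.trans hQR, hw.1.2.2⟩, hw.2⟩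
  · refine monotone_nat_of_le_succ fun Q => ?_
    rw [Finset.sum_Icc_succ_top (by omega)]
    linarith [h0 (Q + 1) (by omega)]
  · intro Q
    rw [Finset.sum_Icc_succ_top (by omega)]
    linarith [hψ 1 (Q + 1) le_rfl (by omega)]

theorem natCard_rat_eq_ncard (P : ℕ × ℤ → Prop) :
    Nat.card {r : ℚ // P (r.den, r.num)} = {w : ℕ × ℤ | 1 ≤ w.1 ∧ w.2.gcd w.1 = 1 ∧ P w}.ncard := by
  rw [← Nat.card_coe_set_eq]
  refine Nat.card_congr (Equiv.ofBijective
    (fun r => ⟨(r.1.den, r.1.num), r.1.pos, r.1.reduced, r.2⟩) ⟨?_, ?_⟩)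
  · intro r s h
    simp only [Subtype.mk.injEq, Prod.mk.injEq] at h
    exact Subtype.ext (Rat.ext h.2 h.1)
  · rintro ⟨⟨q, p⟩, hq, hg, hP⟩
    exact ⟨⟨⟨p, q, by omega, hg⟩, hP⟩, rfl⟩

theorem abs_sub_div_lt_div_iff {q : ℝ} (hq : 0 < q) (x p y : ℝ) :
    |x - p / q| < y / q ↔ |q * x - p| < y := by
  rw [lt_div_iff₀ hq, ← abs_of_pos hq, ← abs_mul, abs_of_pos hq, sub_mul,
    div_mul_cancel₀ _ hq.ne', mul_comm x]

theorem natCard_rat_le_ncard_primitivePairs {ψ : ℕ → ℝ}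
    (hψ : ∀ q r, 1 ≤ q → q ≤ r → ψ r ≤ ψ q) (x : ℝ) {T : ℝ} (hT : 0 < T) :
    (primitivePairs ψ (⌊T⌋₊ - 1) x).ncard ≤ Nat.card {r : ℚ // 1 ≤ r.den ∧ (r.den : ℝ) < T ∧
        |x - (r : ℝ)| < ψ r.den / (r.den : ℝ)} ∧
    Nat.card {r : ℚ // 1 ≤ r.den ∧ (r.den : ℝ) < T ∧
        |x - (r : ℝ)| < ψ r.den / (r.den : ℝ)} ≤ (primitivePairs ψ ⌊T⌋₊ x).ncard := by
  have hfin : (primitivePairs ψ ⌊T⌋₊ x).Finite :=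
    (finite_approxPairs hψ _ x).subset fun w hw => hw.1
  have hcard := natCard_rat_eq_ncard fun w => 1 ≤ w.1 ∧ (w.1 : ℝ) < T ∧
    |x - (w.2 : ℝ) / (w.1 : ℝ)| < ψ w.1 / (w.1 : ℝ)
  simp only [← Rat.cast_def] at hcard
  have hsub : {w : ℕ × ℤ | 1 ≤ w.1 ∧ w.2.gcd w.1 = 1 ∧ 1 ≤ w.1 ∧ (w.1 : ℝ) < T ∧
      |x - (w.2 : ℝ) / (w.1 : ℝ)| < ψ w.1 / (w.1 : ℝ)} ⊆ primitivePairs ψ ⌊T⌋₊ x := by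
    rintro w ⟨hw, hg, -, hwT, hx⟩
    exact ⟨⟨hw, Nat.le_floor hwT.le,
      (abs_sub_div_lt_div_iff (by exact_mod_cast hw) _ _ _).1 hx⟩, hg⟩
  rw [hcard]
  refine ⟨Set.ncard_le_ncard ?_ (hfin.subset hsub), Set.ncard_le_ncard hsub hfin⟩
  rintro w ⟨⟨hw, hwT, hx⟩, hg⟩
  refine ⟨hw, hg, hw, ?_, (abs_sub_div_lt_div_iff (by exact_mod_cast hw) _ _ _).2 hx⟩
  have h1 : w.1 < ⌊T⌋₊ := by omega
  exact (Nat.cast_lt.2 h1).trans_le (Nat.floor_le hT.le)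

theorem tendsto_sum_Icc_div_succ {ψ : ℕ → ℝ} (h0 : ∀ q, 1 ≤ q → 0 ≤ ψ q)
    (hψ : ∀ q r, 1 ≤ q → q ≤ r → ψ r ≤ ψ q)
    (hdiv : Tendsto (fun Q => ∑ q ∈ Finset.Icc 1 Q, ψ q) atTop atTop) :
    Tendsto (fun Q => (∑ q ∈ Finset.Icc 1 Q, ψ q) / ∑ q ∈ Finset.Icc 1 (Q + 1), ψ q) atTop
      (nhds 1) := by
  have hdiv' := hdiv.comp (tendsto_add_atTop_nat 1)
  have hlow : Tendsto (fun Q => 1 - ψ 1 / ∑ q ∈ Finset.Icc 1 (Q + 1), ψ q) atTop (nhds 1) := by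
    simpa using (hdiv'.const_div_atTop (ψ 1)).const_sub 1
  refine tendsto_of_tendsto_of_tendsto_of_le_of_le' hlow tendsto_const_nhds ?_ ?_
  all_goals
    filter_upwards [hdiv'.eventually_gt_atTop 0] with Q hQ
    simp only [Function.comp] at hQ
    have hs := Finset.sum_Icc_succ_top (show 1 ≤ Q + 1 by omega) ψ
  · rw [le_div_iff₀ hQ, sub_mul, div_mul_cancel₀ _ hQ.ne', hs]
    linarith [hψ 1 (Q + 1) le_rfl (by omega)]
  · rw [div_le_iff₀ hQ, hs]
    linarith [h0 (Q + 1) (by omega)]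

end

/-- **Primitive quantitative Khintchine theorem on the line** (Corollary 1.7).
For non-increasing `ψ : ℝ_{>0} → ℝ_{≥0}` with `∑ ψ(q) = ∞`, for almost every `x ∈ ℝ` the
number `N_{ψ,x}(T)` of reduced fractions `p/q` with `|x − p/q| < ψ(q)/q` and `1 ≤ q < T`
satisfies `N_{ψ,x}(T) ∼ 2 ζ(2)⁻¹ ∑_{q ≤ T} ψ(q)` as `T → ∞`. -/
theorem khintchine_primitive_one_dimensional
    (ψ : ℝ → ℝ)
    (hψ_nonneg : ∀ x > (0:ℝ), 0 ≤ ψ x)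
    (hψ_anti : AntitoneOn ψ (Set.Ioi 0))
    (hψ_div : Tendsto (fun Q : ℕ => ∑ q ∈ Finset.Icc 1 Q, ψ q) atTop atTop) :
    ∀ᵐ x : ℝ ∂volume,
      Tendsto (fun T : ℝ =>
        (Nat.card {r : ℚ // 1 ≤ r.den ∧ (r.den : ℝ) < T ∧
            |x - (r : ℝ)| < ψ (r.den : ℝ) / (r.den : ℝ)} : ℝ) /
          (2 * (∑' m : ℕ, (1 : ℝ) / ((m : ℝ) + 1) ^ 2)⁻¹ *
            ∑ q ∈ Finset.Icc 1 ⌊T⌋₊, ψ q))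
        atTop (nhds 1) := by
  set φ : ℕ → ℝ := fun q => ψ q
  set Ψ : ℕ → ℝ := fun Q => ∑ q ∈ Finset.Icc 1 Q, φ q
  set Z : ℝ := ∑' m : ℕ, (1 : ℝ) / ((m : ℝ) + 1) ^ 2
  have hpos : ∀ q : ℕ, 1 ≤ q → (0 : ℝ) < q := fun q hq => by exact_mod_cast hq
  have h0 : ∀ q, 1 ≤ q → 0 ≤ φ q := fun q hq => hψ_nonneg q (hpos q hq)
  have hφ : ∀ q r, 1 ≤ q → q ≤ r → φ r ≤ φ q := fun q r hq hr =>
    hψ_anti (hpos q hq) (hpos r (hq.trans hr)) (Nat.cast_le.2 hr)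
  have hdiv : Tendsto Ψ atTop atTop := hψ_div
  have hZ : 0 < Z := by
    have hs : Summable fun m : ℕ => (1 : ℝ) / ((m : ℝ) + 1) ^ 2 := by
      simpa using (summable_nat_add_iff 1).2 (Real.summable_one_div_nat_pow.2 one_lt_two)
    exact hs.tsum_pos (fun m => by positivity) 0 (by norm_num)
  filter_upwards [ae_tendsto_ncard_primitivePairs_div h0 hφ hdiv] with x hx
  have hlow : Tendsto (fun Q => ((primitivePairs φ Q x).ncard : ℝ) / Ψ (Q + 1)) atTop
      (nhds (2 * Z⁻¹)) := by
    have h := hx.mul (tendsto_sum_Icc_div_succ h0 hφ hdiv)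
    rw [mul_one] at h
    refine h.congr' ?_
    filter_upwards [hdiv.eventually_gt_atTop 0] with Q hQ
    exact div_mul_div_cancel₀ hQ.ne'
  have hfloor : Tendsto (fun T : ℝ => ⌊T⌋₊) atTop atTop := tendsto_nat_floor_atTop
  have hmain : Tendsto (fun T : ℝ =>
      (Nat.card {r : ℚ // 1 ≤ r.den ∧ (r.den : ℝ) < T ∧
        |x - (r : ℝ)| < φ r.den / (r.den : ℝ)} : ℝ) / Ψ ⌊T⌋₊) atTop (nhds (2 * Z⁻¹)) := by
    refine tendsto_of_tendsto_of_tendsto_of_le_of_le'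
      (hlow.comp ((tendsto_sub_atTop_nat 1).comp hfloor)) (hx.comp hfloor) ?_ ?_
    all_goals
      filter_upwards [eventually_ge_atTop 1, (hdiv.comp hfloor).eventually_gt_atTop 0] with T hT hΨ
      obtain ⟨h1, h2⟩ := natCard_rat_le_ncard_primitivePairs hφ x (one_pos.trans_le hT)
    · simp only [Function.comp]
      rw [Nat.sub_add_cancel (Nat.le_floor (by simpa using hT))]
      exact div_le_div_of_nonneg_right (Nat.cast_le.2 h1) hΨ.le
    · exact div_le_div_of_nonneg_right (Nat.cast_le.2 h2) hΨ.le
  have h := hmain.div_const (2 * Z⁻¹)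
  rw [div_self (by positivity)] at h
  refine h.congr fun T => ?_
  rw [div_div, mul_comm (Ψ _)]
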